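/- Let 𝒰 = {q ∈ (1,2) : x = 1 has a unique expansion in base q}. Then 𝒰 ⊆ B_2. Consequently, for every δ > 0 the set B_2 ∩ (q_KL, q_KL + δ) has the cardinality of the continuum, where q_KL = min 𝒰 is the Komornik–Loreti constant. -/

import Mathlib

noncomputable section

/-- `a` is an expansion of `x` in base `q`: all digits `a n` lie in `{0,1}` and
`x = Σ_{n≥1} a_n q^{-n}` (here `a n` is the `(n+1)`-st digit, i.e. indexing is 0-based). -/
def IsExpansion (q x : ℝ) (a : ℕ → ℕ) : Prop :=
  (∀ n, a n ≤ 1) ∧ x = ∑' n : ℕ, (a n : ℝ) / q ^ (n + 1)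

/-- The set of expansions of `x` in base `q`. -/
def expansionsOf (q x : ℝ) : Set (ℕ → ℕ) := {a | IsExpansion q x a}

/-- `U_q`: the set of `x ∈ [0, 1/(q-1)]` having a unique expansion in base `q`. -/
def uniqueExpansionSet (q : ℝ) : Set ℝ :=
  {x | x ∈ Set.Icc 0 (1 / (q - 1)) ∧ ∃! a, IsExpansion q x a}

/-- `B_m` (for finite `m`): bases `q ∈ (G, 2)` for which some `x ∈ I_q` has exactly `m`
expansions in base `q`. -/
def B (m : ℕ) : Set ℝ :=
  {q | q ∈ Set.Ioo ((1 + Real.sqrt 5) / 2) 2 ∧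
    ∃ x ∈ Set.Icc (0:ℝ) (1 / (q - 1)), Cardinal.mk (expansionsOf q x) = m}

/-- `B_{ℵ₀}`: bases `q ∈ (G, 2)` for which some `x ∈ I_q` has exactly countably infinitely
many expansions in base `q`. -/
def Baleph0 : Set ℝ :=
  {q | q ∈ Set.Ioo ((1 + Real.sqrt 5) / 2) 2 ∧
    ∃ x ∈ Set.Icc (0:ℝ) (1 / (q - 1)), Cardinal.mk (expansionsOf q x) = Cardinal.aleph0}

/-- The Thue–Morse sequence: `thueMorse n` is the parity of the number of 1s in the
binary expansion of `n`. -/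
def thueMorse (n : ℕ) : ℕ := ((Nat.digits 2 n).count 1) % 2

/-- A digit `a m` of an expansion of `x` in base `q` is forced if every expansion of `x`
agreeing with `a` before position `m` also agrees at position `m`. -/
def Forced (q x : ℝ) (a : ℕ → ℕ) (m : ℕ) : Prop :=
  ∀ c : ℕ → ℕ, IsExpansion q x c → (∀ i < m, c i = a i) → c m = a m

open Filter Topology

/-- The value `Σ_{n≥1} a_n q^{-n}` of a digit sequence in base `q` (0-based indexing). -/
def expansionValue (q : ℝ) (a : ℕ → ℕ) : ℝ := ∑' n : ℕ, (a n : ℝ) / q ^ (n + 1)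

section ExpansionValue

variable {q : ℝ} {a b : ℕ → ℕ}

lemma summable_one_div_pow_succ (hq : 1 < q) : Summable fun n : ℕ => 1 / q ^ (n + 1) := by
  have h := (summable_geometric_of_lt_one (by positivity) (inv_lt_one_of_one_lt₀ hq))
  refine ((summable_nat_add_iff 1).2 h).congr fun n => ?_
  simp

lemma digit_div_le (hq : 1 < q) (ha : ∀ n, a n ≤ 1) (n : ℕ) :
    (a n : ℝ) / q ^ (n + 1) ≤ 1 / q ^ (n + 1) := by
  have : (a n : ℝ) ≤ 1 := by exact_mod_cast ha n
  have : (0 : ℝ) < q ^ (n + 1) := by positivity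
  gcongr

lemma digit_div_nonneg (hq : 1 < q) (n : ℕ) : 0 ≤ (a n : ℝ) / q ^ (n + 1) := by
  have : (0 : ℝ) < q ^ (n + 1) := by positivity
  positivity

lemma summable_digits (hq : 1 < q) (ha : ∀ n, a n ≤ 1) :
    Summable fun n : ℕ => (a n : ℝ) / q ^ (n + 1) :=
  (summable_one_div_pow_succ hq).of_nonneg_of_le (digit_div_nonneg hq) (digit_div_le hq ha)

lemma expansionValue_nonneg (hq : 1 < q) : 0 ≤ expansionValue q a :=
  tsum_nonneg (digit_div_nonneg hq)

lemma expansionValue_mono (hq : 1 < q) (hb : ∀ n, b n ≤ 1) (hab : ∀ n, a n ≤ b n) :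
    expansionValue q a ≤ expansionValue q b := by
  refine (summable_digits hq fun n => (hab n).trans (hb n)).tsum_le_tsum (fun n => ?_)
    (summable_digits hq hb)
  have : (a n : ℝ) ≤ b n := by exact_mod_cast hab n
  have : (0 : ℝ) < q ^ (n + 1) := by positivity
  gcongr

lemma expansionValue_const_one (hq : 1 < q) : expansionValue q (fun _ => 1) = 1 / (q - 1) := by
  have h0 : q ≠ 0 := by positivity
  have h1 : q - 1 ≠ 0 := by linarith
  have h2 : (1 : ℝ) - q⁻¹ ≠ 0 := by
    have := inv_lt_one_of_one_lt₀ hq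
    linarith
  have : expansionValue q (fun _ => 1) = q⁻¹ * ∑' n : ℕ, q⁻¹ ^ n := by
    rw [expansionValue, ← tsum_mul_left]
    congr 1
    ext n
    simp [pow_succ]
  rw [this, tsum_geometric_of_lt_one (by positivity) (inv_lt_one_of_one_lt₀ hq)]
  field_simp

lemma expansionValue_le (hq : 1 < q) (ha : ∀ n, a n ≤ 1) :
    expansionValue q a ≤ 1 / (q - 1) :=
  expansionValue_const_one hq ▸ expansionValue_mono hq (fun _ => le_rfl) ha

lemma expansionValue_eq_sum_add (hq : 1 < q) (ha : ∀ n, a n ≤ 1) (k : ℕ) :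
    expansionValue q a = ∑ i ∈ Finset.range k, (a i : ℝ) / q ^ (i + 1) +
      expansionValue q (fun n => a (n + k)) / q ^ k := by
  rw [expansionValue, ← (summable_digits hq ha).sum_add_tsum_nat_add k, expansionValue,
    ← tsum_div_const]
  congr 2
  ext n
  rw [div_div, ← pow_add]
  congr 2
  ring

lemma expansionValue_eq_zero_add (hq : 1 < q) (ha : ∀ n, a n ≤ 1) :
    expansionValue q a = (a 0 + expansionValue q (fun n => a (n + 1))) / q := by
  rw [expansionValue_eq_sum_add hq ha 1]
  simp
  ring

lemma expansionValue_pos (hq : 1 < q) (ha : ∀ n, a n ≤ 1) {k : ℕ} (hk : 0 < a k) :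
    0 < expansionValue q a := by
  refine (summable_digits hq ha).tsum_pos (digit_div_nonneg hq) k ?_
  have : (0 : ℝ) < q ^ (k + 1) := by positivity
  have : (0 : ℝ) < a k := by exact_mod_cast hk
  positivity

lemma expansionValue_strictAnti {p : ℝ} (hp : 1 < p) (hpq : p < q) (ha : ∀ n, a n ≤ 1) {k : ℕ}
    (hk : 0 < a k) : expansionValue q a < expansionValue p a := by
  have hq := hp.trans hpq
  refine Summable.tsum_lt_tsum (i := k) (fun n => ?_) ?_ (summable_digits hq ha)
    (summable_digits hp ha)
  · have : (0 : ℝ) < p ^ (n + 1) := by positivity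
    gcongr
  · have : (0 : ℝ) < p ^ (k + 1) := by positivity
    have : (0 : ℝ) < a k := by exact_mod_cast hk
    gcongr

lemma continuousOn_expansionValue (ha : ∀ n, a n ≤ 1) {p r : ℝ} (hp : 1 < p) :
    ContinuousOn (fun q => expansionValue q a) (Set.Icc p r) := by
  refine continuousOn_tsum (u := fun n => 1 / p ^ (n + 1)) (fun n => ?_)
    (summable_one_div_pow_succ hp) fun n x hx => ?_
  · refine continuousOn_const.div (by fun_prop) fun x hx => ?_
    have : 0 < x := by linarith [hx.1]
    positivity
  · have hx1 : 1 < x := by linarith [hx.1]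
    rw [Real.norm_of_nonneg (digit_div_nonneg hx1 n)]
    refine (digit_div_le hx1 ha n).trans ?_
    have : (0 : ℝ) < p ^ (n + 1) := by positivity
    have := hx.1
    gcongr

lemma isExpansion_iff {x : ℝ} :
    IsExpansion q x a ↔ (∀ n, a n ≤ 1) ∧ x = expansionValue q a := Iff.rfl

/-- The expansions of `x` are obtained by prepending a digit to expansions of `q * x - digit`. -/
lemma isExpansion_iff_tail {x : ℝ} (hq : 1 < q) :
    IsExpansion q x a ↔ a 0 ≤ 1 ∧ IsExpansion q (q * x - a 0) (fun n => a (n + 1)) := by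
  have h0 : q ≠ 0 := by positivity
  simp only [isExpansion_iff]
  constructor
  · rintro ⟨ha, hx⟩
    refine ⟨ha 0, fun n => ha _, ?_⟩
    rw [hx, expansionValue_eq_zero_add hq ha]
    field_simp
    ring
  · rintro ⟨ha0, ha, hx⟩
    have ha' : ∀ n, a n ≤ 1 := by
      rintro (_ | n)
      exacts [ha0, ha n]
    refine ⟨ha', ?_⟩
    rw [expansionValue_eq_zero_add hq ha', ← hx]
    field_simp
    ring

/-- Prepend a digit to a sequence. -/
def prependDigit (d : ℕ) (a : ℕ → ℕ) : ℕ → ℕ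
  | 0 => d
  | n + 1 => a n

lemma isExpansion_prependDigit {x : ℝ} (hq : 1 < q) {d : ℕ} (hd : d ≤ 1) :
    IsExpansion q x (prependDigit d a) ↔ IsExpansion q (q * x - d) a := by
  rw [isExpansion_iff_tail hq]
  simp [prependDigit, hd]

lemma eq_prependDigit : a = prependDigit (a 0) (fun n => a (n + 1)) := by
  ext (_ | n) <;> rfl

/-- Remainders of the greedy expansion. -/
def greedyRemainder (q x : ℝ) : ℕ → ℝ
  | 0 => x
  | n + 1 => q * greedyRemainder q x n - if 1 ≤ q * greedyRemainder q x n then 1 else 0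

lemma exists_isExpansion {x : ℝ} (hq : 1 < q) (hq2 : q < 2)
    (hx : x ∈ Set.Icc 0 (1 / (q - 1))) : ∃ a, IsExpansion q x a := by
  have hq1 : 0 < q - 1 := by linarith
  have hmem : ∀ n, greedyRemainder q x n ∈ Set.Icc 0 (1 / (q - 1)) := by
    intro n
    induction n with
    | zero => exact hx
    | succ n ih =>
      obtain ⟨h0, h1⟩ := ih
      rw [le_div_iff₀ hq1] at h1
      simp only [greedyRemainder, Set.mem_Icc, le_div_iff₀ hq1]
      split_ifs with h
      · constructor <;> nlinarith
      · constructor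
        · nlinarith
        · nlinarith
  let a : ℕ → ℕ := fun n => if 1 ≤ q * greedyRemainder q x n then 1 else 0
  have ha : ∀ n, a n ≤ 1 := by
    intro n
    simp only [a]
    split_ifs <;> simp
  have hsum : ∀ n, ∑ i ∈ Finset.range n, (a i : ℝ) / q ^ (i + 1) =
      x - greedyRemainder q x n / q ^ n := by
    intro n
    induction n with
    | zero => simp [greedyRemainder]
    | succ n ih =>
      have : (0 : ℝ) < q ^ n := by positivity
      rw [Finset.sum_range_succ, ih]
      simp only [greedyRemainder, a, pow_succ]
      push_cast
      field_simp
      ring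
  refine ⟨a, ha, ?_⟩
  have h1 := (summable_digits hq ha).hasSum.tendsto_sum_nat
  have h2 : Tendsto (fun n => greedyRemainder q x n / q ^ n) atTop (𝓝 0) := by
    have h3 : Tendsto (fun n : ℕ => 1 / (q - 1) * q⁻¹ ^ n) atTop (𝓝 0) := by
      simpa using (tendsto_pow_atTop_nhds_zero_of_lt_one (by positivity)
        (inv_lt_one_of_one_lt₀ hq)).const_mul (1 / (q - 1))
    refine squeeze_zero (fun n => ?_) (fun n => ?_) h3
    · have := (hmem n).1
      positivity
    · rw [inv_pow, ← div_eq_mul_inv]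
      have := (hmem n).2
      gcongr
  simp only [hsum] at h1
  exact tendsto_nhds_unique (by simpa using h2.const_sub x) h1

lemma expansions_zero (hq : 1 < q) : IsExpansion q 0 a ↔ a = fun _ => 0 := by
  constructor
  · rintro ⟨ha, h⟩
    ext n
    by_contra hn
    exact (expansionValue_pos hq ha (Nat.pos_of_ne_zero hn)).ne h
  · rintro rfl
    simp [IsExpansion]

end ExpansionValue

lemma golden_lt_of_existsUnique {q : ℝ} (hq : q ∈ Set.Ioo (1 : ℝ) 2)
    (h : ∃! a, IsExpansion q 1 a) : (1 + Real.sqrt 5) / 2 < q := by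
  obtain ⟨h1, h2⟩ := hq
  have hq1 : 0 < q - 1 := by linarith
  by_contra! hle
  have h5 : Real.sqrt 5 ^ 2 = 5 := Real.sq_sqrt (by norm_num)
  have hpos : 0 ≤ Real.sqrt 5 := Real.sqrt_nonneg 5
  have hsq : q ^ 2 ≤ q + 1 := by nlinarith
  obtain ⟨a, ha⟩ : ∃ a, IsExpansion q (q * 1 - (0 : ℕ)) a := by
    refine exists_isExpansion h1 h2 ⟨by norm_num; linarith, ?_⟩
    rw [le_div_iff₀ hq1]
    push_cast
    nlinarith
  obtain ⟨b, hb⟩ : ∃ a, IsExpansion q (q * 1 - (1 : ℕ)) a := by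
    refine exists_isExpansion h1 h2 ⟨by norm_num; linarith, ?_⟩
    rw [le_div_iff₀ hq1]
    push_cast
    nlinarith
  have := congrFun (h.unique ((isExpansion_prependDigit h1 zero_le_one).2 ha)
    ((isExpansion_prependDigit h1 le_rfl).2 hb)) 0
  simp [prependDigit] at this

lemma mem_B_two_of_existsUnique {q : ℝ} (hq : q ∈ Set.Ioo (1 : ℝ) 2)
    (h : ∃! a, IsExpansion q 1 a) : q ∈ B 2 := by
  obtain ⟨h1, h2⟩ := hq
  have hq0 : q ≠ 0 := by positivity
  have hq1 : 0 < q - 1 := by linarith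
  refine ⟨⟨golden_lt_of_existsUnique ⟨h1, h2⟩ h, h2⟩, 1 / q, ⟨by positivity, ?_⟩, ?_⟩
  · gcongr
    linarith
  obtain ⟨a, ha, huniq⟩ := h
  have : expansionsOf q (1 / q) = {prependDigit 1 (fun _ => 0), prependDigit 0 a} := by
    ext c
    simp only [expansionsOf, Set.mem_ofPred_eq, Set.mem_insert_iff, Set.mem_singleton_iff]
    constructor
    · intro hc
      rw [isExpansion_iff_tail h1, mul_one_div_cancel hq0] at hc
      obtain ⟨hc0, hc⟩ := hc
      have hcases : c 0 = 1 ∨ c 0 = 0 := by omega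
      rw [eq_prependDigit (a := c)]
      rcases hcases with h0 | h0
      · left
        rw [h0, Nat.cast_one, sub_self, expansions_zero h1] at hc
        rw [h0, hc]
      · right
        rw [h0, Nat.cast_zero, sub_zero] at hc
        rw [h0, huniq _ hc]
    · rintro (rfl | rfl)
      · rw [isExpansion_prependDigit h1 le_rfl, mul_one_div_cancel hq0, Nat.cast_one, sub_self,
          expansions_zero h1]
      · rwa [isExpansion_prependDigit h1 zero_le_one, mul_one_div_cancel hq0, Nat.cast_zero,
          sub_zero]
  rw [this, Cardinal.mk_insert, Cardinal.mk_singleton]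
  · norm_num
  · intro h
    have := congrFun (Set.mem_singleton_iff.1 h) 0
    simp [prependDigit] at this

/-- Strict lexicographic order on binary sequences. -/
def LexLt (u v : ℕ → Bool) : Prop :=
  ∃ k, (∀ j < k, u j = v j) ∧ u k = false ∧ v k = true

/-- The `m`-th tail of `u`, reflected if it starts with the digit `1`. -/
def normalizedTail (u : ℕ → Bool) (m : ℕ) : ℕ → Bool := fun k => u (m + k) ^^ u m

/-- The renormalization `u ↦ u₀ ū₀ u₁ ū₁ …`. -/
def doubling (u : ℕ → Bool) : ℕ → Bool := fun n => u (n / 2) ^^ decide (n % 2 = 1)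

lemma bool_toNat_injective : Function.Injective Bool.toNat := by
  decide

/-- The digits `u 1, u 2, …` as natural numbers. -/
def tailDigits (u : ℕ → Bool) : ℕ → ℕ := fun n => (u (n + 1)).toNat

lemma tailDigits_le (u : ℕ → Bool) (n : ℕ) : tailDigits u n ≤ 1 := Bool.toNat_le _

lemma LexLt.doubling {u v : ℕ → Bool} (h : LexLt u v) : LexLt (doubling u) (doubling v) := by
  obtain ⟨k, hk, h0, h1⟩ := h
  refine ⟨2 * k, fun j hj => ?_, ?_, ?_⟩
  · simp only [_root_.doubling, hk (j / 2) (by omega)]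
  · simp [_root_.doubling, h0]
  · simp [_root_.doubling, h1]

lemma normalizedTail_doubling_even (u : ℕ → Bool) (i : ℕ) :
    normalizedTail (doubling u) (2 * i) = doubling (normalizedTail u i) := by
  ext k
  have h1 : (2 * i + k) / 2 = i + k / 2 := by omega
  have h2 : (2 * i + k) % 2 = k % 2 := by omega
  simp only [normalizedTail, doubling, h1, h2, Nat.mul_div_cancel_left i two_pos,
    Nat.mul_mod_right]
  cases u (i + k / 2) <;> cases u i <;> cases decide (k % 2 = 1) <;> rfl

lemma normalizedTail_doubling_odd (u v : ℕ → Bool) (hv0 : v 0 = false) (hv1 : v 1 = true)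
    (i : ℕ) : LexLt (normalizedTail (doubling u) (2 * i + 1)) (doubling v) := by
  have e1 : (2 * i + 1) / 2 = i := by omega
  have e2 : (2 * i + 1 + 1) / 2 = i + 1 := by omega
  have e3 : (2 * i + 1 + 2) / 2 = i + 1 := by omega
  have e4 : (2 * i + 1) % 2 = 1 := by omega
  have e5 : (2 * i + 1 + 1) % 2 = 0 := by omega
  have e6 : (2 * i + 1 + 2) % 2 = 1 := by omega
  by_cases h : u (i + 1) = u i
  · refine ⟨2, fun j hj => ?_, ?_, ?_⟩
    · interval_cases j
      · simp [normalizedTail, doubling, hv0]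
      · simp only [normalizedTail, doubling, e1, e2, e4, e5, h]
        simp [hv0]
    · simp only [normalizedTail, doubling, e1, e3, e4, e6, h]
      simp
    · simp [doubling, hv1]
  · have h' : u (i + 1) = !u i := by
      revert h
      cases u (i + 1) <;> cases u i <;> simp
    refine ⟨1, fun j hj => ?_, ?_, ?_⟩
    · interval_cases j
      simp [normalizedTail, doubling, hv0]
    · simp only [normalizedTail, doubling, e1, e2, e4, e5, h']
      simp
    · simp [doubling, hv0]

/-- Lexicographic characterization of the unique expansions of `1`, together with
the normalization `u 0 = 0`, `u 1 = 1`. -/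
structure Admissible (u : ℕ → Bool) : Prop where
  zero : u 0 = false
  one : u 1 = true
  lt : ∀ m, 1 ≤ m → LexLt (normalizedTail u m) u

lemma Admissible.doubling {u : ℕ → Bool} (h : Admissible u) : Admissible (doubling u) := by
  refine ⟨by simp [_root_.doubling, h.zero], by simp [_root_.doubling, h.zero], fun m hm => ?_⟩
  obtain ⟨i, rfl | rfl⟩ := Nat.even_or_odd' m
  · rw [normalizedTail_doubling_even]
    exact (h.lt i (by omega)).doubling
  · exact normalizedTail_doubling_odd u u h.zero h.one i

lemma Admissible.iterate_doubling {u : ℕ → Bool} (h : Admissible u) (n : ℕ) :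
    Admissible (_root_.doubling^[n] u) := by
  induction n with
  | zero => exact h
  | succ n ih => rw [Function.iterate_succ_apply']; exact ih.doubling

lemma doubling_injective : Function.Injective doubling := by
  intro u v h
  ext n
  simpa [doubling] using congrFun h (2 * n)

/-- The Thue–Morse sequence with Boolean values. -/
def thueMorseBool (n : ℕ) : Bool := decide (thueMorse n = 1)

lemma thueMorse_lt_two (n : ℕ) : thueMorse n < 2 := Nat.mod_lt _ two_pos

lemma thueMorse_two_mul (n : ℕ) : thueMorse (2 * n) = thueMorse n := by
  rcases Nat.eq_zero_or_pos n with rfl | hn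
  · rfl
  · have := Nat.digits_add_two_add_one 0 (2 * n - 1)
    have e : 2 * n - 1 + 1 = 2 * n := by omega
    rw [e] at this
    simp [thueMorse, this]

lemma thueMorse_two_mul_add_one (n : ℕ) : thueMorse (2 * n + 1) = (thueMorse n + 1) % 2 := by
  have e : (2 * n + 1) / 2 = n := by omega
  simp [thueMorse, e]

lemma doubling_thueMorseBool : doubling thueMorseBool = thueMorseBool := by
  ext n
  obtain ⟨i, rfl | rfl⟩ := Nat.even_or_odd' n
  · simp [doubling, thueMorseBool, thueMorse_two_mul]
  · have e : (2 * i + 1) / 2 = i := by omega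
    have := thueMorse_lt_two i
    simp only [doubling, thueMorseBool, thueMorse_two_mul_add_one, e]
    interval_cases thueMorse i <;> simp

lemma tailDigits_thueMorseBool : tailDigits thueMorseBool = fun n => thueMorse (n + 1) := by
  ext n
  have := thueMorse_lt_two (n + 1)
  simp only [tailDigits, thueMorseBool]
  interval_cases thueMorse (n + 1) <;> rfl

lemma thueMorseBool_no_cube (m : ℕ) :
    ¬(thueMorseBool m = thueMorseBool (m + 1) ∧ thueMorseBool (m + 1) = thueMorseBool (m + 2)) := by
  have key : ∀ i, thueMorseBool (2 * i + 1) = !thueMorseBool (2 * i) := by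
    intro i
    have e : (2 * i + 1) / 2 = i := by omega
    rw [← doubling_thueMorseBool]
    simp [doubling, e]
  obtain ⟨i, rfl | rfl⟩ := Nat.even_or_odd' m
  · simp [key]
  · have := key (i + 1)
    rw [show 2 * i + 1 + 2 = 2 * (i + 1) + 1 by ring, show 2 * i + 1 + 1 = 2 * (i + 1) by ring, this]
    simp

lemma lexLt_of_no_cube {u v : ℕ → Bool} (h0 : v 0 = false) (h1 : v 1 = true) (h2 : v 2 = true)
    (h3 : v 3 = true) {m : ℕ} (hm : ¬(u (m + 1) = u (m + 2) ∧ u (m + 2) = u (m + 3))) :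
    LexLt (normalizedTail u m) v := by
  by_cases k1 : u (m + 1) = u m
  · refine ⟨1, fun j hj => ?_, by simp [normalizedTail, k1], h1⟩
    interval_cases j
    simp [normalizedTail, h0]
  have k1' : (u (m + 1) ^^ u m) = true := by simpa using k1
  by_cases k2 : u (m + 2) = u m
  · refine ⟨2, fun j hj => ?_, by simp [normalizedTail, k2], h2⟩
    interval_cases j
    · simp [normalizedTail, h0]
    · rw [h1]; exact k1'
  have k2' : (u (m + 2) ^^ u m) = true := by simpa using k2
  have k3 : u (m + 3) = u m := by
    revert hm k1 k2
    cases u (m + 1) <;> cases u (m + 2) <;> cases u (m + 3) <;> cases u m <;> simp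
  refine ⟨3, fun j hj => ?_, by simp [normalizedTail, k3], h3⟩
  interval_cases j
  · simp [normalizedTail, h0]
  · rw [h1]; exact k1'
  · rw [h2]; exact k2'

/-- The sequence `0 111 01b₀ 01b₁ 01b₂ …`. -/
def seedSequence (b : ℕ → Bool) (n : ℕ) : Bool :=
  if n = 0 then false
  else if n < 4 then true
  else if n % 3 = 1 then false
  else if n % 3 = 2 then true
  else b (n / 3 - 2)

lemma seedSequence_no_cube (b : ℕ → Bool) {m : ℕ} (hm : 1 ≤ m) :
    ¬(seedSequence b (m + 1) = seedSequence b (m + 2) ∧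
      seedSequence b (m + 2) = seedSequence b (m + 3)) := by
  have k0 : seedSequence b 3 = true := by simp [seedSequence]
  have k1 : ∀ i, 1 ≤ i → seedSequence b (3 * i + 1) = false := by
    intro i hi
    have e1 : ¬ (3 * i + 1 < 4) := by omega
    have e2 : (3 * i + 1) % 3 = 1 := by omega
    simp [seedSequence, e1, e2]
  have k2 : ∀ i, 1 ≤ i → seedSequence b (3 * i + 2) = true := by
    intro i hi
    have e1 : ¬ (3 * i + 2 < 4) := by omega
    have e2 : (3 * i + 2) % 3 = 2 := by omega
    simp [seedSequence, e1, e2]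
  obtain ⟨i, rfl | rfl | rfl⟩ : ∃ i, m = 3 * i ∨ m = 3 * i + 1 ∨ m = 3 * i + 2 :=
    ⟨m / 3, by omega⟩
  · simp [k1 i (by omega), k2 i (by omega)]
  · rcases Nat.eq_zero_or_pos i with rfl | hi
    · have := k1 1 le_rfl
      simp_all
    · have h1 := k1 (i + 1) (by omega)
      have h2 := k2 i hi
      simp only [show 3 * (i + 1) + 1 = 3 * i + 1 + 3 by ring] at h1
      rw [show 3 * i + 1 + 1 = 3 * i + 2 by ring, h1, h2]
      rintro ⟨h3, h4⟩
      rw [h4] at h3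
      simp at h3
  · have h1 := k1 (i + 1) (by omega)
    have h2 := k2 (i + 1) (by omega)
    simp only [show 3 * (i + 1) + 1 = 3 * i + 2 + 2 by ring] at h1
    simp only [show 3 * (i + 1) + 2 = 3 * i + 2 + 3 by ring] at h2
    simp [h1, h2]

lemma seedSequence_admissible (b : ℕ → Bool) : Admissible (seedSequence b) :=
  ⟨by simp [seedSequence], by simp [seedSequence], fun _ hm =>
    lexLt_of_no_cube (by simp [seedSequence]) (by simp [seedSequence]) (by simp [seedSequence])
      (by simp [seedSequence]) (seedSequence_no_cube b hm)⟩

lemma seedSequence_injective : Function.Injective seedSequence := by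
  intro b c h
  ext n
  have e1 : ¬ (3 * (n + 2) < 4) := by omega
  have e2 : (3 * (n + 2)) % 3 = 0 := by omega
  have e3 : 3 * (n + 2) / 3 - 2 = n := by omega
  simpa [seedSequence, e1, e2, e3] using congrFun h (3 * (n + 2))

lemma normalizedTail_thueMorse_lt (b : ℕ → Bool) (n m : ℕ) :
    LexLt (normalizedTail thueMorseBool m) (doubling^[n] (seedSequence b)) := by
  induction n generalizing m with
  | zero =>
    have := thueMorseBool_no_cube (m + 1)
    exact lexLt_of_no_cube (by simp [seedSequence]) (by simp [seedSequence])
      (by simp [seedSequence]) (by simp [seedSequence]) this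
  | succ n ih =>
    rw [Function.iterate_succ_apply', ← doubling_thueMorseBool]
    have h := (seedSequence_admissible b).iterate_doubling n
    obtain ⟨i, rfl | rfl⟩ := Nat.even_or_odd' m
    · rw [normalizedTail_doubling_even]
      exact (ih i).doubling
    · exact normalizedTail_doubling_odd _ _ h.zero h.one i

lemma iterate_doubling_eq_thueMorse {u : ℕ → Bool} (hu : u 0 = false) (n : ℕ) {k : ℕ}
    (hk : k < 2 ^ n) : doubling^[n] u k = thueMorseBool k := by
  induction n generalizing k with
  | zero =>
    obtain rfl : k = 0 := by simpa using hk
    simpa [thueMorseBool, thueMorse] using hu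
  | succ n ih =>
    rw [Function.iterate_succ_apply', ← doubling_thueMorseBool]
    have : k / 2 < 2 ^ n := by rw [pow_succ] at hk; omega
    simp only [doubling, ih this]

section Parry

variable {q : ℝ} {u v : ℕ → Bool}

/-- If `u` agrees with `v` before position `k`, where `u k = 0` and `v k = 1`, the difference of
their values is determined by the tails after `k`. -/
lemma expansionValue_sub_of_lex (hq : 1 < q) {k : ℕ} (hk : ∀ j < k + 1, u j = v j)
    (h0 : u (k + 1) = false) (h1 : v (k + 1) = true) :
    expansionValue q (tailDigits u) - expansionValue q (tailDigits v) =
      (expansionValue q (fun n => tailDigits u (n + (k + 1))) - 1 -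
        expansionValue q (fun n => tailDigits v (n + (k + 1)))) / q ^ (k + 1) := by
  have hs : ∑ i ∈ Finset.range k, (tailDigits u i : ℝ) / q ^ (i + 1) =
      ∑ i ∈ Finset.range k, (tailDigits v i : ℝ) / q ^ (i + 1) := by
    refine Finset.sum_congr rfl fun i hi => ?_
    rw [Finset.mem_range] at hi
    simp only [tailDigits, hk (i + 1) (by omega)]
  rw [expansionValue_eq_sum_add hq (tailDigits_le u) (k + 1),
    expansionValue_eq_sum_add hq (tailDigits_le v) (k + 1), Finset.sum_range_succ,
    Finset.sum_range_succ, hs]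
  have e0 : tailDigits u k = 0 := by simp [tailDigits, h0]
  have e1 : tailDigits v k = 1 := by simp [tailDigits, h1]
  rw [e0, e1]
  push_cast
  ring

lemma normalizedTail_sub_one (hq : 1 < q) (hv0 : v 0 = false)
    (hv : expansionValue q (tailDigits v) = 1) {m : ℕ} (h : LexLt (normalizedTail u m) v) :
    ∃ k, v (k + 1) = true ∧ expansionValue q (tailDigits (normalizedTail u m)) - 1 =
      (expansionValue q (tailDigits (normalizedTail u (m + (k + 1)))) - 1 -
        expansionValue q (fun n => tailDigits v (n + (k + 1)))) / q ^ (k + 1) := by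
  obtain ⟨k, hk, h0, h1⟩ := h
  obtain _ | k := k
  · simp [hv0] at h1
  refine ⟨k, h1, ?_⟩
  have := expansionValue_sub_of_lex hq hk h0 h1
  rw [hv] at this
  rw [this]
  congr 4
  ext n
  have h0' : u (m + (k + 1)) = u m := by simpa [normalizedTail] using h0
  simp only [tailDigits, normalizedTail, h0',
    show m + (n + (k + 1) + 1) = m + (k + 1) + (n + 1) by ring]

lemma expansionValue_normalizedTail_le_one (hq : 1 < q) (hv0 : v 0 = false)
    (hv : expansionValue q (tailDigits v) = 1) {m₀ : ℕ}
    (h : ∀ m ≥ m₀, LexLt (normalizedTail u m) v) {m : ℕ} (hm : m₀ ≤ m) :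
    expansionValue q (tailDigits (normalizedTail u m)) ≤ 1 := by
  have hq1 : 0 < q - 1 := by linarith
  have key : ∀ N : ℕ, ∀ m ≥ m₀, expansionValue q (tailDigits (normalizedTail u m)) - 1 ≤
      1 / (q - 1) * q⁻¹ ^ N := by
    intro N
    induction N with
    | zero =>
      intro m _
      have := expansionValue_le hq (tailDigits_le (normalizedTail u m))
      simp only [pow_zero, mul_one]
      linarith
    | succ N ih =>
      intro m hm
      obtain ⟨k, -, hk⟩ := normalizedTail_sub_one hq hv0 hv (h m hm)
      have h1 := ih (m + (k + 1)) (by omega)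
      have h2 : 0 ≤ expansionValue q (fun n => tailDigits v (n + (k + 1))) :=
        expansionValue_nonneg hq
      have h3 : q ≤ q ^ (k + 1) := le_self_pow₀ hq.le (by omega)
      rw [hk]
      calc _ ≤ (1 / (q - 1) * q⁻¹ ^ N) / q ^ (k + 1) := by
            gcongr
            linarith
        _ ≤ (1 / (q - 1) * q⁻¹ ^ N) / q := by gcongr
        _ = _ := by rw [pow_succ, div_eq_mul_inv, mul_assoc]
  have hlim : Tendsto (fun N : ℕ => 1 / (q - 1) * q⁻¹ ^ N) atTop (𝓝 0) := by
    simpa using (tendsto_pow_atTop_nhds_zero_of_lt_one (by positivity)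
      (inv_lt_one_of_one_lt₀ hq)).const_mul (1 / (q - 1))
  have := ge_of_tendsto' hlim fun N => key N m hm
  linarith

lemma Admissible.expansionValue_normalizedTail_lt_one (hu : Admissible u) (hq : 1 < q)
    (hv : expansionValue q (tailDigits u) = 1) {m : ℕ} (hm : 1 ≤ m) :
    expansionValue q (tailDigits (normalizedTail u m)) < 1 := by
  obtain ⟨k, hk1, hk⟩ := normalizedTail_sub_one hq hu.zero hv (hu.lt m hm)
  have h1 := expansionValue_normalizedTail_le_one hq hu.zero hv hu.lt
    (show 1 ≤ m + (k + 1) by omega)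
  have h2 : 0 < expansionValue q (fun n => tailDigits u (n + (k + 1))) := by
    obtain ⟨j, -, hj0, hj1⟩ := hu.lt (k + 1) (by omega)
    obtain _ | j := j
    · simp [hu.zero] at hj1
    refine expansionValue_pos hq (fun n => tailDigits_le u _) (k := j) ?_
    have : u (j + (k + 1) + 1) = true := by
      rw [show j + (k + 1) + 1 = k + 1 + (j + 1) by ring]
      simpa [normalizedTail, hk1] using hj0
    simp [tailDigits, this]
  have h3 : (expansionValue q (tailDigits (normalizedTail u (m + (k + 1)))) - 1 -
      expansionValue q (fun n => tailDigits u (n + (k + 1)))) / q ^ (k + 1) < 0 :=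
    div_neg_of_neg_of_pos (by linarith) (by positivity)
  linarith

/-- An admissible sequence whose value in base `q` is `1` is the only expansion of `1`. -/
lemma Admissible.eq_of_isExpansion (hu : Admissible u) (hq : 1 < q)
    (hv : expansionValue q (tailDigits u) = 1) {c : ℕ → ℕ} (hc : IsExpansion q 1 c) :
    c = tailDigits u := by
  by_contra hne
  obtain ⟨hc1, hcv⟩ := hc
  change 1 = expansionValue q c at hcv
  have hex : ∃ k, c k ≠ tailDigits u k := Function.ne_iff.1 hne
  classical
  let k := Nat.find hex
  have hk : c k ≠ tailDigits u k := Nat.find_spec hex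
  have hlt : ∀ i < k, c i = tailDigits u i := fun i hi => not_not.1 (Nat.find_min hex hi)
  have hs : ∑ i ∈ Finset.range k, (c i : ℝ) / q ^ (i + 1) =
      ∑ i ∈ Finset.range k, (tailDigits u i : ℝ) / q ^ (i + 1) :=
    Finset.sum_congr rfl fun i hi => by rw [hlt i (Finset.mem_range.1 hi)]
  have heq := hcv.symm.trans hv.symm
  rw [expansionValue_eq_sum_add hq hc1 (k + 1),
    expansionValue_eq_sum_add hq (tailDigits_le u) (k + 1), Finset.sum_range_succ,
    Finset.sum_range_succ, hs, add_assoc, add_assoc, add_right_inj, ← add_div, ← add_div,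
    div_left_inj' (by positivity)] at heq
  have hT := hu.expansionValue_normalizedTail_lt_one hq hv (show 1 ≤ k + 1 by omega)
  have hc0 : 0 ≤ expansionValue q (fun n => c (n + (k + 1))) := expansionValue_nonneg hq
  have hcl := expansionValue_le (a := fun n => c (n + (k + 1))) hq fun n => hc1 _
  have hck := hc1 k
  cases huk : u (k + 1) with
  | false =>
    have e : tailDigits u k = 0 := by simp [tailDigits, huk]
    have e' : c k = 1 := by omega
    have et : tailDigits (normalizedTail u (k + 1)) = fun n => tailDigits u (n + (k + 1)) := by
      ext n
      simp only [tailDigits, normalizedTail, huk, Bool.xor_false]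
      congr 2
      ring
    rw [et] at hT
    rw [e, e'] at heq
    push_cast at heq
    linarith
  | true =>
    have e : tailDigits u k = 1 := by simp [tailDigits, huk]
    have e' : c k = 0 := by omega
    have et : expansionValue q (tailDigits (normalizedTail u (k + 1))) =
        1 / (q - 1) - expansionValue q (fun n => tailDigits u (n + (k + 1))) := by
      rw [← expansionValue_const_one hq, expansionValue, expansionValue, expansionValue,
        ← (summable_digits hq fun _ => le_rfl).tsum_sub
          (summable_digits hq fun n => tailDigits_le u _)]
      congr 1
      ext n
      rw [← sub_div]
      congr 1
      simp only [tailDigits, normalizedTail, huk, Bool.xor_true,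
        show k + 1 + (n + 1) = n + (k + 1) + 1 by ring]
      cases u (n + (k + 1) + 1) <;> simp
    rw [et] at hT
    rw [e, e'] at heq
    push_cast at heq
    linarith

end Parry

/-- The sequences starting with `2 ^ n` Thue–Morse digits, followed by ones, have values
converging to that of the Thue–Morse sequence. -/
lemma tendsto_expansionValue_thueMorse_ones {q : ℝ} (hq : 1 < q) :
    Tendsto (fun n : ℕ => expansionValue q
      (tailDigits fun k => if k < 2 ^ n then thueMorseBool k else true)) atTop
      (𝓝 (expansionValue q (tailDigits thueMorseBool))) := by
  refine tendsto_tsum_of_dominated_convergence (summable_one_div_pow_succ hq) (fun k => ?_)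
    (Eventually.of_forall fun n k => ?_)
  · refine tendsto_const_nhds.congr' ?_
    filter_upwards [eventually_ge_atTop (k + 1)] with n hn
    have : k + 1 < 2 ^ n := hn.trans_lt n.lt_two_pow_self
    simp [tailDigits, this]
  · rw [Real.norm_of_nonneg (digit_div_nonneg hq k)]
    exact digit_div_le hq (tailDigits_le _) k

lemma one_le_expansionValue {u : ℕ → Bool} (h1 : u 1 = true) (h2 : u 2 = true) {q : ℝ}
    (hq : 1 < q) (hq' : q ≤ 3 / 2) : 1 ≤ expansionValue q (tailDigits u) := by
  rw [expansionValue_eq_sum_add hq (tailDigits_le u) 2]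
  have : 0 ≤ expansionValue q (fun n => tailDigits u (n + 2)) / q ^ 2 := by
    have : 0 ≤ expansionValue q (fun n => tailDigits u (n + 2)) := expansionValue_nonneg hq
    positivity
  have e : (1 : ℝ) ≤ 1 / q + 1 / q ^ 2 := by
    rw [div_add_div _ _ (by positivity) (by positivity), le_div_iff₀ (by positivity)]
    nlinarith [mul_nonneg (sub_nonneg.2 hq.le) (sub_nonneg.2 hq')]
  simp only [Finset.sum_range_succ, Finset.sum_range_zero, tailDigits, h1, h2]
  simp only [Bool.toNat_true, Nat.cast_one]
  norm_num at e this ⊢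
  simp only [tailDigits] at this
  linarith

/-- Close to the Komornik–Loreti constant there is a family of bases with unique expansions of `1`,
injectively parametrized by binary sequences. -/
lemma exists_injective_unique_bases {p δ : ℝ} (hp : p ∈ Set.Ioo (1 : ℝ) 2)
    (hpv : expansionValue p (tailDigits thueMorseBool) = 1) (hδ : 0 < δ) :
    ∃ f : (ℕ → Bool) → ℝ, Function.Injective f ∧ ∀ b, f b ∈ Set.Ioo p (p + δ) ∧
      f b ∈ Set.Ioo (1 : ℝ) 2 ∧ ∃! a, IsExpansion (f b) 1 a := by
  obtain ⟨hp1, hp2⟩ := hp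
  obtain ⟨r, hpr, hr⟩ := exists_between (lt_min hp2 (lt_add_of_pos_right p hδ))
  obtain ⟨hr2, hrδ⟩ := lt_min_iff.1 hr
  have hr1 : 1 < r := hp1.trans hpr
  have hpos : 0 < tailDigits thueMorseBool 0 := by
    rw [tailDigits_thueMorseBool]; decide
  have hval : expansionValue r (tailDigits thueMorseBool) < 1 :=
    hpv ▸ expansionValue_strictAnti hp1 hpr (tailDigits_le _) hpos
  obtain ⟨n, hn⟩ := ((tendsto_expansionValue_thueMorse_ones hr1).eventually_lt_const hval).exists
  let s : (ℕ → Bool) → ℕ → Bool := fun b => doubling^[n + 2] (seedSequence b)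
  have hs : ∀ b, Admissible (s b) := fun b => (seedSequence_admissible b).iterate_doubling _
  have hs_lt : ∀ b, expansionValue r (tailDigits (s b)) < 1 := by
    intro b
    refine lt_of_le_of_lt (expansionValue_mono hr1 (tailDigits_le _) fun k => ?_) hn
    simp only [tailDigits]
    split_ifs with h
    · have h' : k + 1 < 2 ^ (n + 2) := h.trans_le (Nat.pow_le_pow_right two_pos (by omega))
      exact (congrArg _ (iterate_doubling_eq_thueMorse (seedSequence_admissible b).zero _ h')).le
    · exact Bool.toNat_le _
  have hs2 : ∀ b, s b 2 = true := by
    intro b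
    have : 2 < 2 ^ (n + 2) := by rw [pow_add]; have := Nat.one_le_two_pow (n := n); omega
    simp only [s]
    rw [iterate_doubling_eq_thueMorse (seedSequence_admissible b).zero _ this]
    simp [thueMorseBool, thueMorse]
  have hbase : ∀ b, ∃ q, 1 < q ∧ q < r ∧ expansionValue q (tailDigits (s b)) = 1 := by
    intro b
    have hr32 : 3 / 2 ≤ r := by
      by_contra! h
      exact absurd (one_le_expansionValue (hs b).one (hs2 b) hr1 h.le) (not_le.2 (hs_lt b))
    obtain ⟨q, ⟨hq1, hq2⟩, hqv⟩ := intermediate_value_Icc' hr32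
      (continuousOn_expansionValue (tailDigits_le (s b)) (by norm_num : (1 : ℝ) < 3 / 2))
      ⟨(hs_lt b).le, one_le_expansionValue (hs b).one (hs2 b) (by norm_num) le_rfl⟩
    refine ⟨q, by linarith, lt_of_le_of_ne hq2 ?_, hqv⟩
    rintro rfl
    exact (hs_lt b).ne hqv
  choose f hf1 hfr hfv using hbase
  refine ⟨f, fun b c hbc => ?_, fun b => ⟨⟨?_, (hfr b).trans hrδ⟩, ⟨hf1 b, (hfr b).trans hr2⟩,
    tailDigits (s b), ⟨tailDigits_le _, (hfv b).symm⟩,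
    fun a ha => (hs b).eq_of_isExpansion (hf1 b) (hfv b) ha⟩⟩
  · have h : tailDigits (s b) = tailDigits (s c) :=
      (hs c).eq_of_isExpansion (hf1 c) (hfv c) ⟨tailDigits_le _, hbc ▸ (hfv b).symm⟩
    have : s b = s c := by
      ext (_ | k)
      · rw [(hs b).zero, (hs c).zero]
      · exact bool_toNat_injective (congrFun h k)
    exact seedSequence_injective (doubling_injective.iterate _ this)
  · have hlex := normalizedTail_thueMorse_lt b (n + 2)
    have hn0 : normalizedTail thueMorseBool 0 = thueMorseBool := by
      ext k
      simp [normalizedTail, show thueMorseBool 0 = false by simp [thueMorseBool, thueMorse]]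
    have hle := expansionValue_normalizedTail_le_one (hf1 b) (hs b).zero (hfv b)
      (m₀ := 0) (fun m _ => hlex m) le_rfl
    rw [hn0] at hle
    refine lt_of_le_of_ne ?_ fun h => ?_
    · by_contra! h
      exact absurd (expansionValue_strictAnti (hf1 b) h (tailDigits_le _) hpos)
        (not_lt.2 (hpv ▸ hle))
    · have h' : tailDigits thueMorseBool = tailDigits (s b) :=
        (hs b).eq_of_isExpansion (hf1 b) (hfv b) ⟨tailDigits_le _, h ▸ hpv.symm⟩
      obtain ⟨k, -, h0, h1⟩ := hlex 0
      rw [hn0] at h0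
      obtain _ | k := k
      · exact Bool.false_ne_true ((hs b).zero.symm.trans h1)
      · have := bool_toNat_injective (congrFun h' k)
        exact Bool.false_ne_true (h0.symm.trans (this.trans h1))

theorem stmt13 (qKL : ℝ) (hqKL : qKL ∈ Set.Ioo (1:ℝ) 2)
    (hqKLeq : ∑' n : ℕ, (thueMorse (n + 1) : ℝ) / qKL ^ (n + 1) = 1) :
    {q : ℝ | q ∈ Set.Ioo (1:ℝ) 2 ∧ ∃! a, IsExpansion q 1 a} ⊆ B 2 ∧
      ∀ δ > (0:ℝ),
        Cardinal.mk (B 2 ∩ Set.Ioo qKL (qKL + δ) : Set ℝ) = Cardinal.continuum := by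
  refine ⟨fun q hq => mem_B_two_of_existsUnique hq.1 hq.2, fun δ hδ => le_antisymm ?_ ?_⟩
  · exact (Cardinal.mk_set_le _).trans Cardinal.mk_real.le
  · have hv : expansionValue qKL (tailDigits thueMorseBool) = 1 := by
      rw [tailDigits_thueMorseBool]
      exact hqKLeq
    obtain ⟨f, hf, hfm⟩ := exists_injective_unique_bases hqKL hv hδ
    have hcard : Cardinal.mk (ℕ → Bool) = Cardinal.continuum := by simp
    rw [← hcard]
    exact Cardinal.mk_le_of_injective
      (f := fun b => (⟨f b, mem_B_two_of_existsUnique (hfm b).2.1 (hfm b).2.2, (hfm b).1⟩ :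
        (B 2 ∩ Set.Ioo qKL (qKL + δ) : Set ℝ)))
      fun b c h => hf (congrArg Subtype.val h)
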